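/- arXiv:2112.10055 — 7 statements merged into one kernel-verified Lean document; each statement's English description precedes it below -/
import Mathlib

section
/- There exists L₀ ≥ 1 depending only on the dimension d such that for every real L ≥ L₀, every ε ∈ (0,1), every ρ ∈ [1,4], every point p ∈ ℝ^d whose d-th coordinate equals L, and all unit vectors v, v' ∈ ℝ^d with ⟨v, e_d⟩ > 0, ⟨v', e_d⟩ > 0, ‖v − e_d‖ < ε/(8L) and ‖v' − e_d‖ < ε/(8L), the lines ℓ = {p + t v : t ∈ ℝ} and ℓ' = {p + t v' : t ∈ ℝ} satisfy the two inclusions B(ℓ', ρ − ε) ∩ B_∞(0,L) ⊆ B(ℓ, ρ) ∩ B_∞(0,L) and B(ℓ, ρ) ∩ B_∞(0,L) ⊆ B(ℓ', ρ + ε) ∩ B_∞(0,L). In other words, within the box B_∞(0,L), the cylinder of radius ρ around a line through p with direction in the spherical cap of radius ε/(8L) around e_d is sandwiched between the cylinders of radii ρ − ε and ρ + ε around any other such line through p. -/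
/-- If `x` has `i`-th coordinate at most `L` in absolute value and lies within `R` of the line
through `p` in direction `w`, then it lies within `R + ε` of the line through `p` in direction `u`,
provided `p i = L` and both directions are within `ε / (8 * L)` of the `i`-th basis vector. -/
theorem infDist_line_le_add {ι : Type*} [Fintype ι] [DecidableEq ι] (i : ι)
    {L ε R : ℝ} (hL : 8 ≤ L) (hε : ε ∈ Set.Ioo (0 : ℝ) 1) (hR : R ≤ 4)
    {p u w x : EuclideanSpace ℝ ι} (hp : p i = L)
    (hu : ‖u - EuclideanSpace.single i (1 : ℝ)‖ < ε / (8 * L))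
    (hw : ‖w - EuclideanSpace.single i (1 : ℝ)‖ < ε / (8 * L))
    (hx : |x i| ≤ L)
    (h : Metric.infDist x {y | ∃ t : ℝ, y = p + t • w} ≤ R) :
    Metric.infDist x {y | ∃ t : ℝ, y = p + t • u} ≤ R + ε := by
  obtain ⟨hε0, hε1⟩ := hε
  have coord_le (z : EuclideanSpace ℝ ι) : |z i| ≤ ‖z‖ := PiLp.norm_apply_le z i
  refine le_of_forall_pos_lt_add fun δ hδ => ?_
  have hne : {y | ∃ t : ℝ, y = p + t • w}.Nonempty := ⟨p + (0 : ℝ) • w, 0, rfl⟩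
  obtain ⟨y, ⟨t, rfl⟩, hy⟩ := (Metric.infDist_lt_iff hne).1
    (h.trans_lt (lt_add_of_pos_right R (lt_min hδ one_pos)))
  have hyδ : dist x (p + t • w) < R + δ := hy.trans_le (by gcongr; exact min_le_left _ _)
  have hy5 : dist x (p + t • w) < 5 := by linarith [min_le_right δ 1]
  have hsmall : ε / (8 * L) ≤ 1 / 8 := by
    rw [div_le_div_iff₀ (by positivity) (by norm_num)]
    linarith
  have hwi : 7 / 8 ≤ w i := by
    have := (coord_le _).trans hw.le
    simp only [PiLp.sub_apply, PiLp.single_apply, if_true] at this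
    linarith [(abs_le.1 this).1]
  have ht : |t| ≤ 4 * L := by
    have h5 := (coord_le (x - (p + t • w))).trans (dist_eq_norm x (p + t • w) ▸ hy5.le)
    simp only [PiLp.sub_apply, PiLp.add_apply, PiLp.smul_apply, smul_eq_mul, hp] at h5
    rw [abs_le] at h5 hx ⊢
    constructor <;> nlinarith [h5.1, h5.2, hx.1, hx.2]
  have huw : ‖w - u‖ ≤ ε / (4 * L) := by
    have := norm_sub_le_norm_sub_add_norm_sub w (EuclideanSpace.single i (1 : ℝ)) u
    rw [norm_sub_rev (EuclideanSpace.single i (1 : ℝ)) u] at this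
    have h2 : ε / (4 * L) = ε / (8 * L) + ε / (8 * L) := by
      field_simp
      norm_num
    linarith
  have hmove : dist (p + t • w) (p + t • u) ≤ ε := by
    rw [dist_add_left, dist_eq_norm, ← smul_sub, norm_smul, Real.norm_eq_abs]
    calc |t| * ‖w - u‖ ≤ 4 * L * (ε / (4 * L)) := by gcongr
      _ = ε := by field_simp
  calc Metric.infDist x {y | ∃ t : ℝ, y = p + t • u}
      ≤ dist x (p + t • u) := Metric.infDist_le_dist_of_mem ⟨t, rfl⟩
    _ ≤ dist x (p + t • w) + dist (p + t • w) (p + t • u) := dist_triangle _ _ _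
    _ < R + ε + δ := by linarith


/-- Within the box `B_∞(0,L)`, the cylinder of radius `ρ` around a line through
`p` whose direction lies in the spherical cap of radius `ε/(8L)` around `e_d` is sandwiched
between the cylinders of radii `ρ − ε` and `ρ + ε` around any other such line through `p`. -/
theorem stmt_1 (d : ℕ) (hd : 3 ≤ d) :
    ∃ L₀ : ℝ, 1 ≤ L₀ ∧
      ∀ L : ℝ, L₀ ≤ L →
      ∀ ε : ℝ, ε ∈ Set.Ioo (0 : ℝ) 1 →
      ∀ ρ : ℝ, ρ ∈ Set.Icc (1 : ℝ) 4 →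
      ∀ p v v' : EuclideanSpace ℝ (Fin d),
        p ⟨d - 1, by omega⟩ = L →
        ‖v‖ = 1 → ‖v'‖ = 1 →
        0 < v ⟨d - 1, by omega⟩ →
        0 < v' ⟨d - 1, by omega⟩ →
        ‖v - EuclideanSpace.single (⟨d - 1, by omega⟩ : Fin d) (1 : ℝ)‖ < ε / (8 * L) →
        ‖v' - EuclideanSpace.single (⟨d - 1, by omega⟩ : Fin d) (1 : ℝ)‖ < ε / (8 * L) →
        ({x | Metric.infDist x {y | ∃ t : ℝ, y = p + t • v'} ≤ ρ - ε} ∩ {x | ∀ i, |x i| ≤ L}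
            ⊆ {x | Metric.infDist x {y | ∃ t : ℝ, y = p + t • v} ≤ ρ} ∩ {x | ∀ i, |x i| ≤ L}) ∧
        ({x | Metric.infDist x {y | ∃ t : ℝ, y = p + t • v} ≤ ρ} ∩ {x | ∀ i, |x i| ≤ L}
            ⊆ {x | Metric.infDist x {y | ∃ t : ℝ, y = p + t • v'} ≤ ρ + ε} ∩ {x | ∀ i, |x i| ≤ L}) := by
  refine ⟨8, by norm_num, ?_⟩
  intro L hL ε hε ρ hρ p v v' hp _ _ _ _ hv hv'
  refine ⟨fun x hx => ⟨?_, hx.2⟩, fun x hx => ⟨?_, hx.2⟩⟩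
  · have := infDist_line_le_add _ hL hε (by linarith [hε.1, hρ.2]) hp hv hv' (hx.2 _) hx.1
    simpa using this
  · exact infDist_line_le_add _ hL hε hρ.2 hp hv' hv (hx.2 _) hx.1
end

section
/- There exists L₀ ≥ 1 depending only on the dimension d such that the following holds for all real L ≥ L₀ and all α, ε ∈ (0,1). Let x₁, x₂, x₃ ∈ ℝ^d satisfy ‖x₁ − x₂‖, ‖x₁ − x₃‖, ‖x₂ − x₃‖ ≥ ε^{−1} L^{2+α} and √2 ≥ ‖(x₁ − x₂)/‖x₁ − x₂‖ − (x₁ − x₃)/‖x₁ − x₃‖‖ ≥ 30 √d · ε/L. Then for all w₁, w₃ ∈ ℝ^d with ‖w₁‖ ≤ 7 √d L^{1+α} and ‖w₃‖ ≤ 7 √d L^{1+α}, the points y₁ = x₁ + w₁ and y₃ = x₃ + w₃ satisfy both ‖(y₃ − y₁)/‖y₃ − y₁‖ − (x₃ − x₁)/‖x₃ − x₁‖‖ < 30 √d · ε/L and ‖(y₃ − y₁)/‖y₃ − y₁‖ − (x₂ − x₁)/‖x₂ − x₁‖‖ > ε/(16 √d L). In particular, the direction of the segment from y₁ to y₃ does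 not lie in the spherical cap of radius ε/(16 √d L) around the unit vector (x₂ − x₁)/‖x₂ − x₁‖. -/
/-- Normalization is Lipschitz away from the origin, with constant `2 / ‖v‖`. -/
theorem norm_mul_norm_normalize_sub_le {E : Type*} [NormedAddCommGroup E] [NormedSpace ℝ E]
    (u v : E) : ‖v‖ * ‖‖u‖⁻¹ • u - ‖v‖⁻¹ • v‖ ≤ 2 * ‖u - v‖ := by
  have cancel (z : E) : ‖z‖ • (‖z‖⁻¹ • z) = z := by
    rcases eq_or_ne z 0 with rfl | hz
    · simp
    · rw [smul_inv_smul₀ (norm_ne_zero_iff.mpr hz)]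
  have hunit : ‖‖u‖⁻¹ • u‖ ≤ 1 := by
    rw [norm_smul, norm_inv, norm_norm]
    exact inv_mul_le_one
  have key : ‖v‖ • (‖u‖⁻¹ • u - ‖v‖⁻¹ • v) = (‖v‖ - ‖u‖) • (‖u‖⁻¹ • u) + (u - v) := by
    rw [smul_sub, sub_smul, cancel, cancel]
    abel
  calc ‖v‖ * ‖‖u‖⁻¹ • u - ‖v‖⁻¹ • v‖ = ‖‖v‖ • (‖u‖⁻¹ • u - ‖v‖⁻¹ • v)‖ := by
        rw [norm_smul, norm_norm]
    _ ≤ ‖(‖v‖ - ‖u‖) • (‖u‖⁻¹ • u)‖ + ‖u - v‖ := by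
        rw [key]
        exact norm_add_le _ _
    _ ≤ ‖u - v‖ * 1 + ‖u - v‖ := by
        rw [norm_smul]
        gcongr
        rw [norm_sub_rev u v]
        exact abs_norm_sub_norm_le v u
    _ = 2 * ‖u - v‖ := by ring


/-- For `L` large (depending only on `d`), well-separated and unaligned points
`x₁, x₂, x₃` remain unaligned after perturbing `x₁` and `x₃` by vectors of norm at most
`7√d L^{1+α}`: the direction from `y₁ = x₁ + w₁` to `y₃ = x₃ + w₃` is within `30√d ε/L` of the
direction from `x₁` to `x₃`, and at distance more than `ε/(16√d L)` from the direction from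
`x₁` to `x₂`. -/
theorem stmt_5 (d : ℕ) (hd : 3 ≤ d) :
    ∃ L₀ : ℝ, 1 ≤ L₀ ∧
      ∀ L : ℝ, L₀ ≤ L →
      ∀ α ∈ Set.Ioo (0 : ℝ) 1, ∀ ε ∈ Set.Ioo (0 : ℝ) 1,
      ∀ x₁ x₂ x₃ : EuclideanSpace ℝ (Fin d),
        ε⁻¹ * L ^ ((2 : ℝ) + α) ≤ ‖x₁ - x₂‖ →
        ε⁻¹ * L ^ ((2 : ℝ) + α) ≤ ‖x₁ - x₃‖ →
        ε⁻¹ * L ^ ((2 : ℝ) + α) ≤ ‖x₂ - x₃‖ →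
        ‖‖x₁ - x₂‖⁻¹ • (x₁ - x₂) - ‖x₁ - x₃‖⁻¹ • (x₁ - x₃)‖ ≤ Real.sqrt 2 →
        30 * Real.sqrt d * ε / L ≤ ‖‖x₁ - x₂‖⁻¹ • (x₁ - x₂) - ‖x₁ - x₃‖⁻¹ • (x₁ - x₃)‖ →
        ∀ w₁ w₃ : EuclideanSpace ℝ (Fin d),
          ‖w₁‖ ≤ 7 * Real.sqrt d * L ^ ((1 : ℝ) + α) →
          ‖w₃‖ ≤ 7 * Real.sqrt d * L ^ ((1 : ℝ) + α) →
          ‖‖(x₃ + w₃) - (x₁ + w₁)‖⁻¹ • ((x₃ + w₃) - (x₁ + w₁)) - ‖x₃ - x₁‖⁻¹ • (x₃ - x₁)‖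
              < 30 * Real.sqrt d * ε / L ∧
          ε / (16 * Real.sqrt d * L)
              < ‖‖(x₃ + w₃) - (x₁ + w₁)‖⁻¹ • ((x₃ + w₃) - (x₁ + w₁)) - ‖x₂ - x₁‖⁻¹ • (x₂ - x₁)‖ := by
  refine ⟨1, le_rfl, ?_⟩
  intro L hL α hα ε hε x₁ x₂ x₃ h₁₂ h₁₃ h₂₃ hle hge w₁ w₃ hw₁ hw₃
  have hL0 : 0 < L := by linarith
  have hε0 : 0 < ε := hε.1
  have hd1 : (1 : ℝ) ≤ √d := Real.one_le_sqrt.mpr (by exact_mod_cast (by omega : 1 ≤ d))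
  set D : ℝ := √d with hD
  set A : ℝ := L ^ ((1 : ℝ) + α) with hA
  have hA0 : 0 < A := Real.rpow_pos_of_pos hL0 _
  have hpow : L ^ ((2 : ℝ) + α) = L * A := by
    rw [hA, show (2 : ℝ) + α = 1 + (1 + α) by ring, Real.rpow_add hL0 1, Real.rpow_one]
  have hnear : ‖‖(x₃ + w₃) - (x₁ + w₁)‖⁻¹ • ((x₃ + w₃) - (x₁ + w₁))
      - ‖x₃ - x₁‖⁻¹ • (x₃ - x₁)‖ ≤ 28 * D * (ε / L) := by
    have hb := norm_mul_norm_normalize_sub_le ((x₃ + w₃) - (x₁ + w₁)) (x₃ - x₁)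
    have hw : ‖(x₃ + w₃) - (x₁ + w₁) - (x₃ - x₁)‖ ≤ 14 * D * A := by
      rw [show (x₃ + w₃) - (x₁ + w₁) - (x₃ - x₁) = w₃ - w₁ by abel]
      linarith [norm_sub_le w₃ w₁]
    have hm : ε⁻¹ * (L * A) ≤ ‖x₃ - x₁‖ := by
      rw [norm_sub_rev, ← hpow]
      exact h₁₃
    have hm0 : 0 < ε⁻¹ * (L * A) := by positivity
    refine le_of_mul_le_mul_left ?_ hm0
    calc _ ≤ _ := mul_le_mul_of_nonneg_right hm (norm_nonneg _)
      _ ≤ 28 * D * A := by linarith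
      _ = _ := by field_simp
  have hfar : 30 * D * (ε / L) ≤ ‖‖x₂ - x₁‖⁻¹ • (x₂ - x₁) - ‖x₃ - x₁‖⁻¹ • (x₃ - x₁)‖ := by
    rw [← neg_sub x₁ x₂, ← neg_sub x₁ x₃, norm_neg, norm_neg, smul_neg, smul_neg,
      neg_sub_neg, norm_sub_rev, ← mul_div_assoc]
    exact hge
  have hq : 0 < ε / L := by positivity
  have hDq : ε / L ≤ D * (ε / L) := le_mul_of_one_le_left hq.le hd1
  constructor
  · rw [mul_div_assoc]
    linarith
  · have hsmall : ε / (16 * D * L) ≤ ε / L :=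
      div_le_div_of_nonneg_left hε0.le hL0 (by nlinarith)
    have htri := norm_sub_le_norm_sub_add_norm_sub (‖x₂ - x₁‖⁻¹ • (x₂ - x₁))
      (‖(x₃ + w₃) - (x₁ + w₁)‖⁻¹ • ((x₃ + w₃) - (x₁ + w₁))) (‖x₃ - x₁‖⁻¹ • (x₃ - x₁))
    rw [norm_sub_rev (‖x₂ - x₁‖⁻¹ • (x₂ - x₁))
      (‖(x₃ + w₃) - (x₁ + w₁)‖⁻¹ • ((x₃ + w₃) - (x₁ + w₁)))] at htri
    linarith
end

section
/- Let L be a positive integer, N an odd positive integer, R = N·L, and z ∈ 2Lℤ^d. Consider the graph whose vertex set is B_∞(z, R) ∩ 2Lℤ^d and in which two points are adjacent when they differ by 2L in exactly one coordinate and agree in all others. For each u ∈ {±e_1, …, ±e_d} let F_u = {y ∈ 2Lℤ^d + L·u : ‖y − z‖_∞ ≤ R and ⟨y − z, u⟩ = R}. Then for any two distinct v, w ∈ {±e_1, …, ±e_d} there exists a collection T of pairwise vertex-disjoint paths in this graph such that for every x₀ ∈ F_v there is a path (z₀, z₁, …, z_n) ∈ T with n ≤ 4R/L, with z₀ = x₀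 − L·v, and with z_n + L·w ∈ F_w. -/
/-- Adjacency in the rescaled lattice `2Lℤ^d`: two points are adjacent when they differ by `2L`
in exactly one coordinate and agree in all others. -/
def coarseAdj (d : ℕ) (L : ℕ) (a b : Fin d → ℤ) : Prop :=
  ∃ j : Fin d, (b j = a j + 2 * (L : ℤ) ∨ b j = a j - 2 * (L : ℤ)) ∧ ∀ i, i ≠ j → b i = a i

/-- Vertices of the coarse graph: points of `2Lℤ^d` in the `ℓ∞` ball `B_∞(z,R)`. -/
def CoarseVert (d : ℕ) (L R : ℕ) (z : Fin d → ℤ) (y : Fin d → ℤ) : Prop :=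
  (∀ i, (2 * (L : ℤ)) ∣ y i) ∧ ∀ i, |y i - z i| ≤ (R : ℤ)

/-- The face `F_u` of `B_∞(z,R)` in direction `u`: points of `2Lℤ^d + L·u` at `ℓ∞` distance at
most `R` from `z` with `⟨y − z, u⟩ = R`. -/
def CoarseFace (d : ℕ) (L R : ℕ) (z u y : Fin d → ℤ) : Prop :=
  (∀ i, ∃ m : ℤ, y i = 2 * (L : ℤ) * m + (L : ℤ) * u i) ∧
  (∀ i, |y i - z i| ≤ (R : ℤ)) ∧
  (∑ i, (y i - z i) * u i) = (R : ℤ)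

/-- `u` is one of `±e_1, …, ±e_d` as an integer vector. -/
def IsSignedUnitZ (d : ℕ) (u : Fin d → ℤ) : Prop :=
  ∃ j : Fin d, (u = fun i => if i = j then 1 else 0) ∨ (u = fun i => if i = j then -1 else 0)

/-- A family of lattice paths in the cube `{-k, …, k}^d`, one for each point `s` of the face
`x j = σ k`, that ends on the face `x j' = τ k`. The retraction `I` recovers `s` from any point of
its path, so the paths are disjoint. -/
theorem exists_disjoint_cube_paths (d k : ℕ) (j j' : Fin d) (σ τ : ℤ) (hσ : σ = 1 ∨ σ = -1)
    (hτ : τ = 1 ∨ τ = -1) (h : j ≠ j' ∨ σ = -τ) :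
    ∃ (n : (Fin d → ℤ) → ℕ) (p : (Fin d → ℤ) → ℕ → Fin d → ℤ) (I : (Fin d → ℤ) → Fin d → ℤ),
      ∀ s : Fin d → ℤ, (∀ i, |s i| ≤ k) → s j = σ * k →
        n s ≤ 4 * k ∧ p s 0 = s ∧ p s (n s) j' = τ * k ∧
        (∀ i < n s, ∃ l, (p s (i + 1) l = p s i l + 1 ∨ p s (i + 1) l = p s i l - 1) ∧
          ∀ a, a ≠ l → p s (i + 1) a = p s i a) ∧
        ∀ i ≤ n s, (∀ l, |p s i l| ≤ k) ∧ I (p s i) = s := by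
  by_cases hj : j = j'
  · subst hj
    have hτ' : τ = -σ := by rcases h with h | h <;> [exact absurd rfl h; omega]
    refine ⟨fun _ => 2 * k, fun s i l => if l = j then σ * (k - i) else s l,
      fun x l => if l = j then σ * k else x l, fun s hs hsj => ?_⟩
    beta_reduce
    refine ⟨by omega, ?_, ?_, ?_, ?_⟩
    · funext l
      by_cases hl : l = j
      · simp [hl, hsj]
      · simp [hl]
    · simp only [if_true, hτ']
      push_cast
      ring
    · intro i _
      refine ⟨j, ?_, fun a ha => by simp [ha]⟩
      simp only [if_true]
      push_cast
      rcases hσ with rfl | rfl <;> omega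
    · intro i hi
      refine ⟨fun l => ?_, ?_⟩
      · by_cases hl : l = j
        · simp only [hl, if_true]
          rw [abs_le]
          rcases hσ with rfl | rfl <;> constructor <;> omega
        · simpa [hl] using hs l
      · funext l
        by_cases hl : l = j
        · simp [hl, hsj]
        · simp [hl]
  · have hj' : j' ≠ j := Ne.symm hj
    refine ⟨fun s => 2 * (k - τ * s j').toNat,
      fun s i l => if l = j then σ * (k - (min i (k - τ * s j').toNat : ℕ))
        else if l = j' then τ * (τ * s j' + (i - (k - τ * s j').toNat : ℕ)) else s l,
      fun x l => if l = j then σ * k else if l = j' then τ * min (σ * x j) (τ * x j') else x l,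
      fun s hs hsj => ?_⟩
    beta_reduce
    have hb := abs_le.mp (hs j')
    have hττ : τ * (τ * s j') = s j' := by rcases hτ with rfl | rfl <;> ring
    have hb1 : τ * s j' ≤ k := by rcases hτ with rfl | rfl <;> omega
    have hb2 : -(k : ℤ) ≤ τ * s j' := by rcases hτ with rfl | rfl <;> omega
    generalize τ * s j' = b at *
    obtain ⟨c, hc⟩ : ∃ c : ℕ, (k - b).toNat = c := ⟨_, rfl⟩
    have hc' : (c : ℤ) = k - b := by omega
    simp only [hc]
    refine ⟨by omega, ?_, ?_, ?_, ?_⟩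
    · funext l
      by_cases hl : l = j
      · simp [hl, hsj]
      · by_cases hl' : l = j'
        · simp [hl', hj', hττ]
        · simp [hl, hl']
    · simp only [hj', if_true, if_false]
      congr 1
      omega
    · intro i _
      by_cases hic : i < c
      · refine ⟨j, ?_, fun a ha => ?_⟩
        · simp only [if_true]
          rcases hσ with rfl | rfl <;> omega
        · have h1 : i + 1 - c = i - c := by omega
          simp [ha, h1]
      · refine ⟨j', ?_, fun a ha => ?_⟩
        · simp only [hj', if_true, if_false]
          rcases hτ with rfl | rfl <;> omega
        · have h1 : min (i + 1) c = min i c := by omega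
          simp [ha, h1]
    · intro i hi
      refine ⟨fun l => ?_, ?_⟩
      · by_cases hl : l = j
        · simp only [hl, if_true]
          rw [abs_le]
          rcases hσ with rfl | rfl <;> constructor <;> omega
        · by_cases hl' : l = j'
          · simp only [hl', hj', if_true, if_false]
            rw [abs_le]
            rcases hτ with rfl | rfl <;> constructor <;> omega
          · simpa [hl, hl'] using hs l
      · funext l
        by_cases hl : l = j
        · simp [hl, hsj]
        · by_cases hl' : l = j'
          · simp only [hl', hj', if_true, if_false]
            rw [← hττ]
            congr 1
            rcases hσ with rfl | rfl <;> rcases hτ with rfl | rfl <;> omega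
          · simp [hl, hl']

/-- A signed unit vector is `σ e_j` for a sign `σ`. -/
theorem IsSignedUnitZ.exists_sign {d : ℕ} {u : Fin d → ℤ} (hu : IsSignedUnitZ d u) :
    ∃ (j : Fin d) (σ : ℤ), (σ = 1 ∨ σ = -1) ∧ u = fun i => if i = j then σ else 0 := by
  obtain ⟨j, h | h⟩ := hu
  · exact ⟨j, 1, Or.inl rfl, h⟩
  · exact ⟨j, -1, Or.inr rfl, h⟩

/-- The points of the face in direction `σ e_j` are, after stepping inward, the points
`z + 2 L m` with `m` in the face `m j = σ k` of the cube. -/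
theorem coarseFace_iff {d k L : ℕ} (hL : 0 < L) {z : Fin d → ℤ} (hz : ∀ i, (2 * (L : ℤ)) ∣ z i)
    {j : Fin d} {σ : ℤ} (hσ : σ = 1 ∨ σ = -1) (m : Fin d → ℤ) :
    CoarseFace d L ((2 * k + 1) * L) z (fun i => if i = j then σ else 0)
      (fun i => z i + 2 * L * m i + L * (if i = j then σ else 0)) ↔
      (∀ i, |m i| ≤ k) ∧ m j = σ * k := by
  have hL' : (0 : ℤ) < L := by exact_mod_cast hL
  have hsq : σ * σ = 1 := by rcases hσ with rfl | rfl <;> rfl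
  have key : ((2 * k + 1 : ℤ) * L = (2 * L * m j + L * σ) * σ) ↔ m j = σ * k := by
    constructor
    · intro h
      have h1 : (L : ℤ) * (2 * (m j * σ - k)) = 0 := by linear_combination -h - L * hsq
      have h2 : m j * σ = k := by
        rcases mul_eq_zero.mp h1 with h | h <;> omega
      linear_combination σ * h2 - m j * hsq
    · intro h
      rw [h]
      linear_combination (-(2 * L * k) - L : ℤ) * hsq
  have hsum : (∑ i, ((z i + 2 * L * m i + L * (if i = j then σ else 0)) - z i) *
      (if i = j then σ else 0)) = (2 * L * m j + L * σ) * σ := by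
    rw [Finset.sum_eq_single j]
    · simp only [if_true]
      ring
    · intro b _ hb
      simp [hb]
    · simp
  unfold CoarseFace
  rw [hsum]
  push_cast
  rw [eq_comm (a := (2 * L * m j + L * σ) * σ), key]
  constructor
  · rintro ⟨-, h2, h3⟩
    refine ⟨fun i => ?_, h3⟩
    by_cases hi : i = j
    · rw [hi, h3, abs_mul]
      rcases hσ with rfl | rfl <;> simp
    · have h := h2 i
      simp only [hi, if_false, mul_zero, add_zero, add_sub_cancel_left, abs_le] at h
      rw [abs_le]
      constructor
      · have : (L : ℤ) * (-(2 * k + 1)) ≤ L * (2 * m i) := by linarith [h.1]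
        have := le_of_mul_le_mul_left this hL'
        omega
      · have : (L : ℤ) * (2 * m i) ≤ L * (2 * k + 1) := by linarith [h.2]
        have := le_of_mul_le_mul_left this hL'
        omega
  · rintro ⟨h1, h2⟩
    refine ⟨fun i => ?_, fun i => ?_, h2⟩
    · obtain ⟨q, hq⟩ := hz i
      exact ⟨q + m i, by rw [hq]; ring⟩
    · have e : z i + 2 * L * m i + L * (if i = j then σ else 0) - z i =
          (2 * m i + (if i = j then σ else 0)) * L := by ring
      rw [e, abs_mul, abs_of_pos hL']
      refine mul_le_mul_of_nonneg_right ?_ hL'.le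
      have := abs_le.mp (h1 i)
      rw [abs_le]
      split_ifs <;> rcases hσ with rfl | rfl <;> constructor <;> omega

/-- In the graph on `B_∞(z,R) ∩ 2Lℤ^d` (with `R = N·L`, `N` odd) where points
are adjacent when they differ by `2L` in exactly one coordinate, for any two distinct signed
unit directions `v, w` there is a collection `T` of pairwise vertex-disjoint paths such that
every `x₀ ∈ F_v` is the start (after stepping inward by `L·v`) of some path in `T` of at most
`4R/L` steps whose final vertex, shifted by `L·w`, lies in `F_w`. -/
theorem stmt_10 (d : ℕ) (hd : 3 ≤ d) (L N R : ℕ) (hL : 0 < L) (hN : Odd N) (hN0 : 0 < N)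
    (hR : R = N * L) (z : Fin d → ℤ) (hz : ∀ i, (2 * (L : ℤ)) ∣ z i)
    (v w : Fin d → ℤ) (hv : IsSignedUnitZ d v) (hw : IsSignedUnitZ d w) (hvw : v ≠ w) :
    ∃ T : Set (List (Fin d → ℤ)),
      (∀ P ∈ T, P ≠ [] ∧ P.Chain' (coarseAdj d L) ∧ ∀ x ∈ P, CoarseVert d L R z x) ∧
      (∀ P ∈ T, ∀ Q ∈ T, P ≠ Q → ∀ x, x ∈ P → x ∉ Q) ∧
      (∀ x₀ : Fin d → ℤ, CoarseFace d L R z v x₀ →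
        ∃ P ∈ T, P.length ≤ 4 * N + 1 ∧
          P.head? = some (fun i => x₀ i - (L : ℤ) * v i) ∧
          ∃ y, P.getLast? = some y ∧ CoarseFace d L R z w (fun i => y i + (L : ℤ) * w i)) := by
  obtain ⟨k, rfl⟩ := hN
  subst hR
  obtain ⟨j, σ, hσ, rfl⟩ := hv.exists_sign
  obtain ⟨j', τ, hτ, rfl⟩ := hw.exists_sign
  have hL' : (0 : ℤ) < L := by exact_mod_cast hL
  have hne : j ≠ j' ∨ σ = -τ := by
    by_contra! hc
    obtain ⟨rfl, hc⟩ := hc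
    apply hvw
    have : σ = τ := by omega
    rw [this]
  obtain ⟨n, p, I, H⟩ := exists_disjoint_cube_paths d k j j' σ τ hσ hτ hne
  let emb : (Fin d → ℤ) → Fin d → ℤ := fun m i => z i + 2 * L * m i
  have hemb : Function.Injective emb := by
    intro a b hab
    funext i
    have h1 : z i + 2 * L * a i = z i + 2 * L * b i := congrFun hab i
    have h2 : (2 * (L : ℤ)) * a i = (2 * L) * b i := by linarith
    exact mul_left_cancel₀ (by omega) h2
  let path : (Fin d → ℤ) → List (Fin d → ℤ) :=
    fun s => (List.range (n s + 1)).map fun i => emb (p s i)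
  refine ⟨{P | ∃ s : Fin d → ℤ, (∀ i, |s i| ≤ k) ∧ s j = σ * k ∧ P = path s}, ?_, ?_, ?_⟩
  · rintro P ⟨s, hs, hsj, rfl⟩
    obtain ⟨-, -, -, hadj, hbox⟩ := H s hs hsj
    refine ⟨by simp [path], ?_, ?_⟩
    · refine List.isChain_iff_getElem.mpr fun i hi => ?_
      simp only [path, List.length_map, List.length_range] at hi
      obtain ⟨l, h1, h2⟩ := hadj i (by omega)
      simp only [path, List.getElem_map, List.getElem_range]
      refine ⟨l, ?_, fun a ha => ?_⟩
      · rcases h1 with h1 | h1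
        · left
          simp only [emb, h1]
          ring
        · right
          simp only [emb, h1]
          ring
      · simp only [emb, h2 a ha]
    · intro x hx
      obtain ⟨i, hi, rfl⟩ := List.mem_map.mp hx
      have hb := (hbox i (by have := List.mem_range.mp hi; omega)).1
      refine ⟨fun l => dvd_add (hz l) (dvd_mul_right _ _), fun l => ?_⟩
      have e : emb (p s i) l - z l = (2 * p s i l) * L := by
        simp only [emb]
        ring
      rw [e, abs_mul, abs_of_pos hL']
      push_cast
      refine mul_le_mul_of_nonneg_right ?_ hL'.le
      have := abs_le.mp (hb l)
      rw [abs_le]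
      constructor <;> omega
  · rintro P ⟨s, hs, hsj, rfl⟩ Q ⟨t, ht, htj, rfl⟩ hPQ x hx hx'
    obtain ⟨a, ha, hax⟩ := List.mem_map.mp hx
    obtain ⟨b, hb, hbx⟩ := List.mem_map.mp hx'
    have ha' := List.mem_range.mp ha
    have hb' := List.mem_range.mp hb
    have h1 := ((H s hs hsj).2.2.2.2 a (by omega)).2
    have h2 := ((H t ht htj).2.2.2.2 b (by omega)).2
    have h3 : p s a = p t b := hemb (hax.trans hbx.symm)
    exact hPQ (by rw [← h1, ← h2, h3])
  · intro x₀ hx₀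
    obtain ⟨s, rfl⟩ : ∃ s : Fin d → ℤ,
        x₀ = fun i => z i + 2 * L * s i + L * (if i = j then σ else 0) := by
      choose q hq using hx₀.1
      choose r hr using hz
      refine ⟨fun i => q i - r i, funext fun i => ?_⟩
      rw [hq i]
      linear_combination -(hr i)
    obtain ⟨hs, hsj⟩ := (coarseFace_iff hL hz hσ s).mp hx₀
    obtain ⟨hlen, hstart, hend, -, hbox⟩ := H s hs hsj
    refine ⟨path s, ⟨s, hs, hsj, rfl⟩, ?_, ?_, emb (p s (n s)), ?_, ?_⟩
    · simp only [path, List.length_map, List.length_range]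
      omega
    · simp [path, List.range_succ_eq_map, hstart, emb]
    · simp [path, List.range_succ]
    · exact (coarseFace_iff hL hz hτ _).mpr ⟨(hbox _ le_rfl).1, hend⟩
end

section
/- Let ε ∈ (0,1) and ρ ∈ [1,4]. There exists L₀ ≥ 1 depending only on the dimension d such that for every real L ≥ L₀ the following holds: if ℓ = {p + t v : t ∈ ℝ} is a line whose unit direction v satisfies ⟨v, e_d⟩ > 0 and ‖v − e_d‖ < ε/(8L), and if ℓ intersects B(B_∞(0,L), ρ(1+ε)) (the set of points within Euclidean distance ρ(1+ε) of the box B_∞(0,L)), then ℓ intersects the square S₁ = [−2L, 2L]^{d−1} × {L}. -/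
/-- There exists `L₀ ≥ 1` depending only on `d` such that for all
`ε ∈ (0,1)`, `ρ ∈ [1,4]` and `L ≥ L₀`: any line whose unit direction `v` satisfies
`⟨v, e_d⟩ > 0` and `‖v − e_d‖ < ε/(8L)` and which intersects `B(B_∞(0,L), ρ(1+ε))` must also
intersect the square `S₁ = [−2L, 2L]^{d−1} × {L}`. -/
theorem stmt_11 (d : ℕ) (hd : 3 ≤ d) :
    ∃ L₀ : ℝ, 1 ≤ L₀ ∧
      ∀ ε ∈ Set.Ioo (0 : ℝ) 1, ∀ ρ ∈ Set.Icc (1 : ℝ) 4,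
      ∀ L : ℝ, L₀ ≤ L →
      ∀ p v : EuclideanSpace ℝ (Fin d), ‖v‖ = 1 →
        0 < v ⟨d - 1, by omega⟩ →
        ‖v - EuclideanSpace.single (⟨d - 1, by omega⟩ : Fin d) (1 : ℝ)‖ < ε / (8 * L) →
        (∃ x, (∃ t : ℝ, x = p + t • v) ∧
          Metric.infDist x {y : EuclideanSpace ℝ (Fin d) | ∀ i, |y i| ≤ L} ≤ ρ * (1 + ε)) →
        ∃ t : ℝ, (p + t • v) ⟨d - 1, by omega⟩ = L ∧
          ∀ i : Fin d, i ≠ ⟨d - 1, by omega⟩ → |(p + t • v) i| ≤ 2 * L := by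
  refine ⟨100, by norm_num, ?_⟩
  rintro ε ⟨hε0, hε1⟩ ρ ⟨hρ1, hρ4⟩ L hL p v - - hv ⟨x, ⟨t, rfl⟩, hx⟩
  generalize (⟨d - 1, by omega⟩ : Fin d) = k at *
  set x := p + t • v with hxdef
  have hL0 : 0 < L := by linarith
  have hδ : ε / (8 * L) ≤ 1 / (8 * L) := by gcongr
  have hδ_half : 1 / (8 * L) ≤ 1 / 2 := by
    rw [div_le_div_iff₀ (by positivity) (by norm_num)]
    linarith
  have hv_near : ∀ i, |v i - EuclideanSpace.single k (1 : ℝ) i| ≤ 1 / (8 * L) := fun i => by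
    have := PiLp.norm_apply_le (v - EuclideanSpace.single k (1 : ℝ)) i
    rw [Real.norm_eq_abs, PiLp.sub_apply] at this
    linarith
  have hvk : 1 / 2 ≤ v k := by
    have := abs_le.mp (hv_near k)
    simp only [PiLp.single_apply, if_true] at this
    linarith [this.1]
  have hx_coord : ∀ i, |x i| ≤ L + 9 := by
    have hlt : Metric.infDist x {y : EuclideanSpace ℝ (Fin d) | ∀ i, |y i| ≤ L} < 9 := by
      nlinarith
    obtain ⟨y, hy, hxy⟩ := (Metric.infDist_lt_iff ⟨0, fun i => by simpa using hL0.le⟩).mp hlt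
    intro i
    have hi := PiLp.norm_apply_le (x - y) i
    rw [← dist_eq_norm, Real.norm_eq_abs, PiLp.sub_apply] at hi
    have := abs_sub_abs_le_abs_sub (x i) (y i)
    linarith [hy i]
  set s := (L - x k) / v k with hs
  have hsv : s * v k = L - x k := div_mul_cancel₀ _ (by linarith)
  have hs_le : |s| ≤ 4 * L + 18 := by
    have h1 : |s| * v k = |L - x k| := by
      rw [← hsv, abs_mul, abs_of_pos (by linarith : 0 < v k)]
    have h2 : |L - x k| ≤ 2 * L + 9 := by
      have := abs_sub L (x k)
      rw [abs_of_pos hL0] at this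
      linarith [hx_coord k]
    nlinarith [abs_nonneg s]
  have hline : ∀ i, (p + (t + s) • v) i = x i + s * v i := fun i => by
    simp only [hxdef, PiLp.add_apply, PiLp.smul_apply, smul_eq_mul]
    ring
  refine ⟨t + s, by rw [hline, hsv]; ring, fun i hi => ?_⟩
  have hvi : |v i| ≤ 1 / (8 * L) := by simpa [hi] using hv_near i
  have hsvi : |s * v i| ≤ 1 := by
    rw [abs_mul]
    calc |s| * |v i| ≤ (4 * L + 18) * (1 / (8 * L)) := by gcongr
      _ ≤ 1 := by
        rw [mul_one_div, div_le_one (by positivity)]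
        linarith
  rw [hline]
  linarith [abs_add_le (x i) (s * v i), hx_coord i]
end

section
/- Let α, ε ∈ (0,1), and for L > 0 set B₁ = B_∞(0, L) and B₂ = B₁ + (2L + L^{2+α} ε^{−1}) e_d. There exists L₀ ≥ 1 depending only on the dimension d and on α such that for every real L ≥ L₀ the following holds: if a line ℓ intersects both B(B₁, 8) and B(B₂, 8), then its unit direction v, normalized so that ⟨v, e_d⟩ > 0, satisfies ‖v − e_d‖ < ε/(8L). -/
/-- A point within distance `8` of a nonempty set is within distance `9` of one of its points,
coordinatewise. -/
lemma exists_abs_coord_sub_le {ι : Type*} [Fintype ι] {s : Set (EuclideanSpace ℝ ι)}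
    (hs : s.Nonempty) {x : EuclideanSpace ℝ ι} (hx : Metric.infDist x s ≤ 8) :
    ∃ a ∈ s, ∀ i, |x i - a i| ≤ 9 := by
  obtain ⟨a, ha, hxa⟩ := (Metric.infDist_lt_iff hs).1 (lt_of_le_of_lt hx (by norm_num : (8 : ℝ) < 9))
  refine ⟨a, ha, fun i => ?_⟩
  rw [dist_eq_norm] at hxa
  have h := PiLp.norm_apply_le (x - a) i
  rw [PiLp.sub_apply, Real.norm_eq_abs] at h
  linarith

/-- If the multiple `u • v` of a unit vector `v` has all coordinates but the `k`-th bounded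
by `R`, then the distance from `v` to the `k`-th basis vector is at most of order `R / u`. -/
lemma sq_mul_norm_sub_single_sq_le {ι : Type*} [Fintype ι] [DecidableEq ι]
    {v : EuclideanSpace ℝ ι} (hv : ‖v‖ = 1) {k : ι} (hk : 0 < v k) {u R : ℝ}
    (h : ∀ i, i ≠ k → |u * v i| ≤ R) :
    u ^ 2 * ‖v - EuclideanSpace.single k (1 : ℝ)‖ ^ 2 ≤ 2 * (Fintype.card ι * R ^ 2) := by
  have hsum : ∑ i, v i ^ 2 = 1 := by
    have := EuclideanSpace.real_norm_sq_eq v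
    rw [hv] at this
    linarith
  have hnorm : ‖v - EuclideanSpace.single k (1 : ℝ)‖ ^ 2 = 2 - 2 * v k := by
    rw [norm_sub_sq_real, hv, EuclideanSpace.inner_single_right, PiLp.norm_single]
    simp
    ring
  have hsplit : v k ^ 2 + ∑ i ∈ Finset.univ.erase k, v i ^ 2 = 1 := by
    rw [Finset.add_sum_erase _ (fun i => v i ^ 2) (Finset.mem_univ k), hsum]
  have hrest : u ^ 2 * ∑ i ∈ Finset.univ.erase k, v i ^ 2 ≤ Fintype.card ι * R ^ 2 := by
    rw [Finset.mul_sum]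
    calc ∑ i ∈ Finset.univ.erase k, u ^ 2 * v i ^ 2
        ≤ ∑ _i ∈ Finset.univ.erase k, R ^ 2 := by
          refine Finset.sum_le_sum fun i hi => ?_
          rw [← mul_pow]
          exact sq_le_sq' (neg_le_of_abs_le (h i (Finset.ne_of_mem_erase hi)))
            (le_of_abs_le (h i (Finset.ne_of_mem_erase hi)))
      _ ≤ ∑ _i : ι, R ^ 2 :=
          Finset.sum_le_sum_of_subset_of_nonneg (Finset.erase_subset _ _)
            fun _ _ _ => sq_nonneg R
      _ = Fintype.card ι * R ^ 2 := by simp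
  have hle : v k ≤ 1 := by
    have : 0 ≤ ∑ i ∈ Finset.univ.erase k, v i ^ 2 := Finset.sum_nonneg fun _ _ => sq_nonneg _
    nlinarith
  have hcmp : ‖v - EuclideanSpace.single k (1 : ℝ)‖ ^ 2 ≤
      2 * ∑ i ∈ Finset.univ.erase k, v i ^ 2 := by
    rw [hnorm]
    nlinarith
  nlinarith [mul_le_mul_of_nonneg_left hcmp (sq_nonneg u)]


/-- For `α ∈ (0,1)` there exists `L₀ ≥ 1` (depending only on `d` and `α`)
such that for all `ε ∈ (0,1)` and `L ≥ L₀`: if a line intersects both `B(B₁, 8)` and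
`B(B₂, 8)`, where `B₁ = B_∞(0,L)` and `B₂ = B₁ + (2L + L^{2+α}/ε) e_d`, then its unit
direction `v`, normalized so that `⟨v, e_d⟩ > 0`, satisfies `‖v − e_d‖ < ε/(8L)`. -/
theorem stmt_12 (d : ℕ) (hd : 3 ≤ d) (α : ℝ) (hα : α ∈ Set.Ioo (0 : ℝ) 1) :
    ∃ L₀ : ℝ, 1 ≤ L₀ ∧
      ∀ ε ∈ Set.Ioo (0 : ℝ) 1, ∀ L : ℝ, L₀ ≤ L →
      ∀ p v : EuclideanSpace ℝ (Fin d), ‖v‖ = 1 →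
        0 < v ⟨d - 1, by omega⟩ →
        (∃ x, (∃ t : ℝ, x = p + t • v) ∧
          Metric.infDist x {y : EuclideanSpace ℝ (Fin d) | ∀ i, |y i| ≤ L} ≤ 8) →
        (∃ x, (∃ t : ℝ, x = p + t • v) ∧
          Metric.infDist x {y : EuclideanSpace ℝ (Fin d) |
            ∀ i, |y i - EuclideanSpace.single (⟨d - 1, by omega⟩ : Fin d)
              (2 * L + L ^ ((2 : ℝ) + α) / ε) i| ≤ L} ≤ 8) →
        ‖v - EuclideanSpace.single (⟨d - 1, by omega⟩ : Fin d) (1 : ℝ)‖ < ε / (8 * L) := by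
  obtain ⟨hα0, -⟩ := hα
  have hd1 : (3 : ℝ) ≤ d := by exact_mod_cast hd
  have hbase : (0 : ℝ) ≤ 36 * d + 18 := by positivity
  have hpow0 : (0 : ℝ) ≤ (36 * d + 18 : ℝ) ^ (1 / α) := Real.rpow_nonneg hbase _
  refine ⟨18 + (36 * d + 18 : ℝ) ^ (1 / α), by linarith, ?_⟩
  rintro ε ⟨hε0, hε1⟩ L hL p v hv hvk ⟨x, ⟨t, rfl⟩, hx⟩ ⟨y, ⟨s, rfl⟩, hy⟩
  have hL18 : 18 ≤ L := by linarith
  have hL0 : 0 < L := by linarith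
  have hLα : 36 * d + 18 ≤ L ^ α := by
    calc (36 * d + 18 : ℝ) = ((36 * d + 18 : ℝ) ^ (1 / α)) ^ α := by
          rw [← Real.rpow_mul hbase, one_div_mul_cancel hα0.ne', Real.rpow_one]
      _ ≤ L ^ α := Real.rpow_le_rpow hpow0 (by linarith) hα0.le
  set k : Fin d := ⟨d - 1, by omega⟩
  set K : ℝ := L ^ ((2 : ℝ) + α) / ε with hKdef
  have hK : (36 * d + 18) * (L ^ 2 / ε) ≤ K := by
    rw [hKdef, Real.rpow_add hL0, Real.rpow_two, mul_comm (L ^ 2), mul_div_assoc]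
    gcongr
  have hLε : 1 ≤ L ^ 2 / ε := by
    rw [le_div_iff₀ hε0]
    nlinarith
  have hKlow : 36 * d * (L ^ 2 / ε) ≤ K - 18 := by linarith
  obtain ⟨a, ha, hxa⟩ := exists_abs_coord_sub_le ⟨0, fun i => by simpa using hL0.le⟩ hx
  obtain ⟨b, hb, hyb⟩ := exists_abs_coord_sub_le
    ⟨EuclideanSpace.single k (2 * L + K), fun i => by simpa using hL0.le⟩ hy
  have hcoord : ∀ i, i ≠ k → |(s - t) * v i| ≤ 3 * L := by
    intro i hi
    have h1 := abs_le.1 (hxa i)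
    have h2 := abs_le.1 (hyb i)
    have h3 := abs_le.1 (ha i)
    have h4 := hb i
    simp only [PiLp.single_apply, hi, if_false, sub_zero] at h4
    have h4 := abs_le.1 h4
    simp only [PiLp.add_apply, PiLp.smul_apply, smul_eq_mul] at h1 h2
    exact abs_le.2 ⟨by linarith, by linarith⟩
  have hheight : K - 18 ≤ (s - t) * v k := by
    have h1 := abs_le.1 (hxa k)
    have h2 := abs_le.1 (hyb k)
    have h3 := abs_le.1 (ha k)
    have h4 := hb k
    simp only [PiLp.single_apply, if_true] at h4
    have h4 := abs_le.1 h4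
    simp only [PiLp.add_apply, PiLp.smul_apply, smul_eq_mul] at h1 h2
    linarith
  have hvk1 : v k ≤ 1 := by
    have := PiLp.norm_apply_le v k
    rw [hv, Real.norm_eq_abs] at this
    exact (abs_le.1 this).2
  have hlow : 36 * d * (L ^ 2 / ε) ≤ s - t := by
    have hpos : 0 < 36 * d * (L ^ 2 / ε) := by positivity
    have hst : 0 < s - t := pos_of_mul_pos_left (by linarith) hvk.le
    nlinarith
  have hmain := sq_mul_norm_sub_single_sq_le hv hvk hcoord
  rw [Fintype.card_fin] at hmain
  by_contra! hcon
  have hδ : (0 : ℝ) ≤ ε / (8 * L) := by positivity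
  have hprod : 36 * d * (L ^ 2 / ε) * (ε / (8 * L)) ≤
      (s - t) * ‖v - EuclideanSpace.single k (1 : ℝ)‖ :=
    mul_le_mul hlow hcon hδ (le_trans (by positivity) hlow)
  have heq : 36 * d * (L ^ 2 / ε) * (ε / (8 * L)) = 9 / 2 * (d * L) := by
    field_simp
    ring
  rw [heq] at hprod
  have hsq := pow_le_pow_left₀ (by positivity) hprod 2
  rw [mul_pow (s - t)] at hsq
  have : (d : ℝ) * L ^ 2 * (81 / 4 * d) ≤ d * L ^ 2 * 18 := by nlinarith
  have := le_of_mul_le_mul_left this (by positivity)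
  linarith
end

section
/- There exists a constant κ_d > 0 depending only on the dimension d such that for every integer n ≥ 1 and every real m ≥ 1 the following holds in the nearest-neighbor graph on K = {0, 1, …, n}^d: if A ⊆ K and B ⊆ K are connected subsets with |A| ≥ m and |B| ≥ m, and H ⊆ K is disjoint from A ∪ B and satisfies |H| < κ_d · m^{(d−1)/d}, then there exists a nearest-neighbor path contained in K ∖ H that connects some point of A to some point of B. -/
/-- Nearest-neighbor adjacency in `ℤ^d`. -/
def latAdj (d : ℕ) (a b : Fin d → ℤ) : Prop :=
  ∃ j : Fin d, (b j = a j + 1 ∨ b j = a j - 1) ∧ ∀ i, i ≠ j → b i = a i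

/-- The discrete box `K = {0, 1, …, n}^d ⊆ ℤ^d`. -/
def boxK (d n : ℕ) : Set (Fin d → ℤ) := {x | ∀ i, 0 ≤ x i ∧ x i ≤ (n : ℤ)}

/-- A subset `S` of `ℤ^d` induces a connected subgraph of the nearest-neighbor lattice:
any two of its points are joined by a nearest-neighbor path inside `S`. -/
def ConnectedIn (d : ℕ) (S : Set (Fin d → ℤ)) : Prop :=
  ∀ a ∈ S, ∀ b ∈ S, ∃ n : ℕ, ∃ path : ℕ → (Fin d → ℤ),
    path 0 = a ∧ path n = b ∧ (∀ k ≤ n, path k ∈ S) ∧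
    ∀ k < n, latAdj d (path k) (path (k + 1))

theorem ENNReal.sum_prod_rpow_le {α ι : Type*} (T : Finset α) (s : Finset ι) (f : ι → α → ENNReal)
    {p : ι → ℝ} (hp : ∑ i ∈ s, p i = 1) (hp₀ : ∀ i ∈ s, 0 ≤ p i) :
    ∑ a ∈ T, ∏ i ∈ s, f i a ^ p i ≤ ∏ i ∈ s, (∑ a ∈ T, f i a) ^ p i := by
  let _ : MeasurableSpace α := ⊤
  have h := lintegral_prod_norm_pow_le (μ := MeasureTheory.Measure.count.restrict (T : Set α)) s
    (f := f) (fun i _ => measurable_from_top.aemeasurable) hp hp₀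
  simpa [MeasureTheory.lintegral_finset] using h

/-- Hölder's inequality for finite sums of natural numbers, freed from roots. -/
theorem Finset.sum_pow_le_mul_prod_sum {α : Type*} (T : Finset α) {d : ℕ} (hd : d ≠ 0) (C : ℕ)
    (c : α → ℕ) (g : Fin d → α → ℕ) (h : ∀ a ∈ T, c a ^ d ≤ C * ∏ i, g i a) :
    (∑ a ∈ T, c a) ^ d ≤ C * ∏ i, ∑ a ∈ T, g i a := by
  have hd' : (d : ℝ) ≠ 0 := by exact_mod_cast hd
  have hr : (0 : ℝ) ≤ (d : ℝ)⁻¹ := by positivity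
  have hpt : ∀ a ∈ T, (c a : ENNReal) ≤
      (C : ENNReal) ^ (d : ℝ)⁻¹ * ∏ i, (g i a : ENNReal) ^ (d : ℝ)⁻¹ := by
    intro a ha
    rw [ENNReal.prod_rpow_of_nonneg hr, ← ENNReal.mul_rpow_of_nonneg _ _ hr,
      ENNReal.le_rpow_inv_iff (by positivity), ENNReal.rpow_natCast]
    exact_mod_cast h a ha
  have key := (Finset.sum_le_sum hpt).trans_eq (Finset.mul_sum _ _ _).symm
  have hol := ENNReal.sum_prod_rpow_le T Finset.univ (fun i a => (g i a : ENNReal))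
    (p := fun _ => (d : ℝ)⁻¹) (by simp [hd']) (fun _ _ => hr)
  have := key.trans (mul_le_mul_right hol _)
  rw [ENNReal.prod_rpow_of_nonneg hr, ← ENNReal.mul_rpow_of_nonneg _ _ hr,
      ENNReal.le_rpow_inv_iff (by positivity), ENNReal.rpow_natCast] at this
  exact_mod_cast this

/-- The discrete Loomis–Whitney inequality. -/
theorem Finset.card_pow_le_prod_card_image_removeNth {α : Type*} [DecidableEq α] {d : ℕ}
    (S : Finset (Fin (d + 1) → α)) (hS : S.Nonempty) :
    S.card ^ d ≤ ∏ i : Fin (d + 1), (S.image fun x => i.removeNth x).card := by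
  induction d with
  | zero => simpa using hS
  | succ d ih =>
    let T := S.image fun x => x 0
    let slice (a : α) : Finset (Fin (d + 1) → α) := (S.filter fun x => x 0 = a).image Fin.tail
    have mem_slice (a : α) (y : Fin (d + 1) → α) : y ∈ slice a ↔ Fin.cons a y ∈ S := by
      simp only [slice, Finset.mem_image, Finset.mem_filter]
      constructor
      · rintro ⟨x, ⟨hx, rfl⟩, rfl⟩
        simpa using hx
      · exact fun h => ⟨_, ⟨h, by simp⟩, by simp⟩
    have card_slices : S.card = ∑ a ∈ T, (slice a).card := by
      rw [Finset.card_eq_sum_card_image fun x : Fin (d + 2) → α => x 0]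
      refine Finset.sum_congr rfl fun a _ => (Finset.card_image_of_injOn ?_).symm
      intro x hx y hy hxy
      simp only [Finset.coe_filter, Set.mem_ofPred_eq] at hx hy
      rw [← Fin.cons_self_tail x, ← Fin.cons_self_tail y, hx.2, hy.2, hxy]
    have slice_pow (a : α) (ha : a ∈ T) : (slice a).card ^ (d + 1) ≤
        (S.image fun x => (0 : Fin (d + 2)).removeNth x).card *
          ∏ i : Fin (d + 1), ((slice a).image fun x => i.removeNth x).card := by
      rw [pow_succ']
      refine Nat.mul_le_mul (Finset.card_le_card fun y hy => ?_) (ih _ ?_)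
      · exact Finset.mem_image.2 ⟨_, (mem_slice a y).1 hy, by simp⟩
      · obtain ⟨x, hx, rfl⟩ := Finset.mem_image.1 ha
        exact ⟨Fin.tail x, (mem_slice _ _).2 (by simpa using hx)⟩
    have sum_slices (i : Fin (d + 1)) :
        ∑ a ∈ T, ((slice a).image fun x => i.removeNth x).card ≤
          (S.image fun x => i.succ.removeNth x).card := by
      rw [← Finset.card_sigma]
      refine Finset.card_le_card_of_injOn (fun p => Fin.cons p.1 p.2) ?_ ?_
      · rintro ⟨a, z⟩ h
        simp only [Finset.coe_sigma, Set.mem_sigma_iff, Finset.mem_coe, Finset.mem_image] at h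
        obtain ⟨-, y, hy, rfl⟩ := h
        refine Finset.mem_coe.2 (Finset.mem_image.2 ⟨_, (mem_slice a y).1 hy, ?_⟩)
        ext j
        refine Fin.cases ?_ (fun j => ?_) j <;> simp [Fin.removeNth]
      · rintro ⟨a, z⟩ - ⟨b, w⟩ - h
        obtain ⟨rfl, rfl⟩ := Fin.cons_inj.1 h
        rfl
    calc S.card ^ (d + 1) = (∑ a ∈ T, (slice a).card) ^ (d + 1) := by rw [card_slices]
      _ ≤ _ := Finset.sum_pow_le_mul_prod_sum T d.succ_ne_zero _ _ _ slice_pow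
      _ ≤ _ := Nat.mul_le_mul_left _ (Finset.prod_le_prod' fun i _ => sum_slices i)
      _ = _ := (Fin.prod_univ_succ fun i : Fin (d + 2) =>
        (S.image fun x => i.removeNth x).card).symm

theorem latAdj.symm {d : ℕ} {a b : Fin d → ℤ} (h : latAdj d a b) : latAdj d b a := by
  obtain ⟨j, hj, h⟩ := h
  exact ⟨j, by omega, fun i hi => (h i hi).symm⟩

theorem latAdj_insertNth_add_one {d : ℕ} (i : Fin (d + 1)) (k : ℤ) (y : Fin d → ℤ) :
    latAdj (d + 1) (i.insertNth k y) (i.insertNth (k + 1) y) := by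
  refine ⟨i, by simp, fun j hj => ?_⟩
  obtain ⟨j, rfl⟩ := Fin.exists_succAbove_eq hj
  simp

theorem insertNth_mem_boxK {d n : ℕ} {i : Fin (d + 1)} {x : Fin (d + 1) → ℤ}
    (hx : x ∈ boxK (d + 1) n) {k : ℤ} (hk : 0 ≤ k) (hkn : k ≤ n) :
    i.insertNth k (i.removeNth x) ∈ boxK (d + 1) n := by
  intro j
  refine Fin.succAboveCases i ?_ (fun j => ?_) j
  · simpa using ⟨hk, hkn⟩
  · simpa [Fin.removeNth] using hx _

/-- A line which meets `S` and avoids the boundary `H` of `S` is contained in `S`. -/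
theorem insertNth_mem_of_line_disjoint {d n : ℕ} {S H : Set (Fin (d + 1) → ℤ)}
    (hbd : ∀ a ∈ boxK (d + 1) n \ H, ∀ b ∈ boxK (d + 1) n \ H,
      latAdj (d + 1) a b → a ∈ S → b ∈ S)
    {i : Fin (d + 1)} {x : Fin (d + 1) → ℤ} (hx : x ∈ boxK (d + 1) n) (hxS : x ∈ S)
    (hH : ∀ h ∈ H, i.removeNth h ≠ i.removeNth x) {k : ℤ} (hk : 0 ≤ k) (hkn : k ≤ n) :
    i.insertNth k (i.removeNth x) ∈ S := by
  have hline (k : ℤ) (hk : 0 ≤ k) (hkn : k ≤ n) :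
      i.insertNth k (i.removeNth x) ∈ boxK (d + 1) n \ H :=
    ⟨insertNth_mem_boxK hx hk hkn, fun h => hH _ h (by simp)⟩
  have hconst (k : ℕ) (hkn : k ≤ n) : (i.insertNth (k : ℤ) (i.removeNth x) ∈ S ↔
      i.insertNth (0 : ℤ) (i.removeNth x) ∈ S) := by
    induction k with
    | zero => simp
    | succ k ih =>
      rw [← ih (by omega)]
      have h₁ := hline k (by omega) (by omega)
      have h₂ := hline (k + 1) (by omega) (by omega)
      have hadj := latAdj_insertNth_add_one i k (i.removeNth x)
      push_cast
      exact ⟨hbd _ h₂ _ h₁ hadj.symm, hbd _ h₁ _ h₂ hadj⟩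
  lift k to ℕ using hk
  rw [hconst k (by omega)]
  obtain ⟨h0, h1⟩ := hx i
  obtain ⟨l, hl⟩ := Int.eq_ofNat_of_zero_le h0
  rw [← hconst l (by omega), ← hl, Fin.insertNth_self_removeNth]
  exact hxS

/-- The vertex isoperimetric inequality in the box, for sets occupying at most half of it. -/
theorem isoperimetric_boxK {d n : ℕ} (S H : Finset (Fin (d + 1) → ℤ)) (hS : S.Nonempty)
    (hSK : ↑S ⊆ boxK (d + 1) n) (hhalf : 2 * S.card ≤ (n + 1) ^ (d + 1))
    (hbd : ∀ a ∈ boxK (d + 1) n \ H, ∀ b ∈ boxK (d + 1) n \ H,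
      latAdj (d + 1) a b → a ∈ S → b ∈ S) :
    (1 - (2 : ℝ) ^ (-((d + 1 : ℕ) : ℝ)⁻¹)) * (S.card : ℝ) ^ ((d : ℝ) / (d + 1 : ℕ)) ≤ H.card := by
  obtain ⟨i, -, hi⟩ : ∃ i ∈ Finset.univ,
      S.card ^ d ≤ (S.image fun x => (i : Fin (d + 1)).removeNth x).card ^ (d + 1) := by
    by_contra! hlt
    have hprod := Finset.prod_lt_prod_of_nonempty
      (fun i _ => pow_pos (Finset.card_pos.2 (hS.image fun x => (i : Fin (d + 1)).removeNth x))
        (d + 1)) hlt Finset.univ_nonempty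
    rw [Finset.prod_pow, Finset.prod_const, Finset.card_univ, Fintype.card_fin] at hprod
    exact hprod.not_ge (Nat.pow_le_pow_left (S.card_pow_le_prod_card_image_removeNth hS) _)
  set P := S.image fun x => i.removeNth x
  set Q := H.image fun x => i.removeNth x
  have hfull : (P \ Q).card * (n + 1) ≤ S.card := by
    have hcard : (Finset.Icc (0 : ℤ) n).card = n + 1 := by simp
    rw [← hcard, ← Finset.card_product]
    refine Finset.card_le_card_of_injOn (fun p => i.insertNth p.2 p.1) ?_ ?_
    · rintro ⟨y, k⟩ h
      simp only [Finset.mem_coe, Finset.mem_product, Finset.mem_sdiff, Finset.mem_Icc] at h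
      obtain ⟨⟨hyP, hyQ⟩, hk, hkn⟩ := h
      obtain ⟨x, hxS, rfl⟩ := Finset.mem_image.1 hyP
      exact insertNth_mem_of_line_disjoint (S := ↑S) hbd (hSK hxS) hxS
        (fun h hh he => hyQ (Finset.mem_image.2 ⟨h, hh, he⟩)) hk hkn
    · rintro ⟨y, k⟩ - ⟨z, l⟩ - h
      obtain ⟨rfl, rfl⟩ := Fin.insertNth_inj.1 h
      rfl
  have hPH : P.card ≤ (P \ Q).card + H.card := by
    have h₁ := Finset.le_card_sdiff Q P
    have h₂ : Q.card ≤ H.card := Finset.card_image_le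
    omega
  have hD : (0 : ℝ) < ((d + 1 : ℕ) : ℝ) := by positivity
  set t : ℝ := (S.card : ℝ) ^ ((d + 1 : ℕ) : ℝ)⁻¹ with ht
  set c : ℝ := (2 : ℝ) ^ ((d + 1 : ℕ) : ℝ)⁻¹ with hc
  have hs₀ : (0 : ℝ) < S.card := by exact_mod_cast Finset.card_pos.2 hS
  have ht₀ : 0 < t := by positivity
  have hc₀ : 0 < c := by positivity
  have hts : t ^ (d + 1) = S.card := Real.rpow_inv_natCast_pow hs₀.le d.succ_ne_zero
  have hc2 : c ^ (d + 1) = 2 := Real.rpow_inv_natCast_pow (by norm_num) d.succ_ne_zero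
  have htd : (S.card : ℝ) ^ ((d : ℝ) / (d + 1 : ℕ)) = t ^ d := by
    rw [ht, ← Real.rpow_natCast, ← Real.rpow_mul hs₀.le, div_eq_inv_mul]
  have hside : c * t ≤ n + 1 := by
    refine le_of_pow_le_pow_left₀ d.succ_ne_zero (by positivity) ?_
    rw [mul_pow, hts, hc2]
    exact_mod_cast hhalf
  have hP : t ^ d ≤ P.card := by
    refine le_of_pow_le_pow_left₀ d.succ_ne_zero (by positivity) ?_
    rw [← pow_mul, mul_comm, pow_mul, hts]
    exact_mod_cast hi
  have hF : ((P \ Q).card : ℝ) * c ≤ t ^ d := by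
    have h₁ : ((P \ Q).card : ℝ) * (n + 1) ≤ t ^ (d + 1) := by
      rw [hts]
      exact_mod_cast hfull
    refine le_of_mul_le_mul_right ?_ ht₀
    calc ((P \ Q).card : ℝ) * c * t = (P \ Q).card * (c * t) := mul_assoc _ _ _
      _ ≤ (P \ Q).card * (n + 1) := by gcongr
      _ ≤ t ^ d * t := by rwa [← pow_succ]
  rw [← le_div_iff₀ hc₀] at hF
  have hPH' : (P.card : ℝ) ≤ (P \ Q).card + H.card := by exact_mod_cast hPH
  rw [htd, Real.rpow_neg (by norm_num), ← hc, sub_mul, one_mul, inv_mul_eq_div]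
  linarith

theorem coe_piFinset_Icc_eq_boxK (d n : ℕ) :
    (↑(Fintype.piFinset fun _ : Fin d => Finset.Icc (0 : ℤ) n) : Set (Fin d → ℤ)) = boxK d n := by
  ext x
  simp [boxK, Pi.le_def, forall_and]

theorem boxK_finite (d n : ℕ) : (boxK d n).Finite :=
  coe_piFinset_Icc_eq_boxK d n ▸ Finset.finite_toSet _

theorem ncard_boxK (d n : ℕ) : (boxK d n).ncard = (n + 1) ^ d := by
  rw [← coe_piFinset_Icc_eq_boxK, Set.ncard_coe_finset]
  simp

/-- The boundary of a set splitting the box into two parts of size at least `m` is large. -/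
theorem separator_ncard_ge {d n : ℕ} {m : ℝ} (hm : 1 ≤ m) {S H : Set (Fin (d + 1) → ℤ)}
    (hSK : S ⊆ boxK (d + 1) n) (hH : H ⊆ boxK (d + 1) n) (hS : m ≤ S.ncard)
    (hSc : m ≤ (boxK (d + 1) n \ S).ncard)
    (hbd : ∀ a ∈ boxK (d + 1) n \ H, ∀ b ∈ boxK (d + 1) n \ H,
      latAdj (d + 1) a b → a ∈ S → b ∈ S) :
    (1 - (2 : ℝ) ^ (-((d + 1 : ℕ) : ℝ)⁻¹)) * m ^ ((d : ℝ) / (d + 1 : ℕ)) ≤ H.ncard := by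
  wlog hhalf : 2 * S.ncard ≤ (n + 1) ^ (d + 1) generalizing S
  · have hadd := Set.ncard_sdiff_add_ncard_of_subset hSK (boxK_finite _ _)
    rw [ncard_boxK] at hadd
    refine this Set.sdiff_subset hSc (by rwa [Set.sdiff_sdiff_cancel_left hSK]) ?_ (by omega)
    exact fun a ha b hb hab haS => ⟨hb.1, fun hbS => haS.2 (hbd b hb a ha hab.symm hbS)⟩
  lift S to Finset (Fin (d + 1) → ℤ) using (boxK_finite _ _).subset hSK
  lift H to Finset (Fin (d + 1) → ℤ) using (boxK_finite _ _).subset hH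
  rw [Set.ncard_coe_finset] at *
  have hne : S.Nonempty := by
    rw [← Finset.card_pos]
    exact_mod_cast zero_lt_one.trans_le (hm.trans hS)
  refine le_trans ?_ (isoperimetric_boxK S H hne hSK hhalf hbd)
  have hc : (2 : ℝ) ^ (-((d + 1 : ℕ) : ℝ)⁻¹) ≤ 1 :=
    Real.rpow_le_one_of_one_le_of_nonpos (by norm_num) (by simp; positivity)
  gcongr

/-- The points reachable from `A` by nearest-neighbor paths inside `G`. -/
def reachableIn (d : ℕ) (G A : Set (Fin d → ℤ)) : Set (Fin d → ℤ) :=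
  {x | ∃ k : ℕ, ∃ path : ℕ → (Fin d → ℤ), path 0 ∈ A ∧ path k = x ∧ (∀ j ≤ k, path j ∈ G) ∧
    ∀ j < k, latAdj d (path j) (path (j + 1))}

theorem reachableIn_subset (d : ℕ) (G A : Set (Fin d → ℤ)) : reachableIn d G A ⊆ G := by
  rintro x ⟨k, path, -, rfl, hG, -⟩
  exact hG k le_rfl

theorem subset_reachableIn {d : ℕ} {G A : Set (Fin d → ℤ)} (h : A ⊆ G) :
    A ⊆ reachableIn d G A :=
  fun x hx => ⟨0, fun _ => x, hx, rfl, fun _ _ => h hx, by simp⟩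

theorem mem_reachableIn_of_latAdj {d : ℕ} {G A : Set (Fin d → ℤ)} {a b : Fin d → ℤ}
    (ha : a ∈ reachableIn d G A) (hb : b ∈ G) (hab : latAdj d a b) : b ∈ reachableIn d G A := by
  obtain ⟨k, path, h0, rfl, hG, hadj⟩ := ha
  refine ⟨k + 1, fun j => if j ≤ k then path j else b, by simpa, by simp, fun j _ => ?_,
    fun j hj => ?_⟩
  · dsimp only
    split_ifs with h
    exacts [hG j h, hb]
  · obtain hj | rfl := (Nat.lt_succ_iff.1 hj).lt_or_eq
    · simpa [hj.le, Nat.succ_le_of_lt hj] using hadj j hj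
    · simpa using hab

/-- There is `κ_d > 0` depending only on `d` such that for every `n ≥ 1` and
`m ≥ 1`: if `A, B ⊆ K = {0,…,n}^d` are connected sets of cardinality at least `m`, and
`H ⊆ K` is disjoint from `A ∪ B` with `|H| < κ_d m^{(d−1)/d}`, then some nearest-neighbor path
contained in `K ∖ H` connects a point of `A` to a point of `B`. -/
theorem stmt_13 (d : ℕ) (hd : 3 ≤ d) :
    ∃ κ : ℝ, 0 < κ ∧
      ∀ n : ℕ, 1 ≤ n → ∀ m : ℝ, 1 ≤ m →
      ∀ A B H : Set (Fin d → ℤ),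
        A ⊆ boxK d n → B ⊆ boxK d n → H ⊆ boxK d n →
        ConnectedIn d A → ConnectedIn d B →
        m ≤ (A.ncard : ℝ) → m ≤ (B.ncard : ℝ) →
        Disjoint H (A ∪ B) →
        (H.ncard : ℝ) < κ * m ^ (((d : ℝ) - 1) / (d : ℝ)) →
        ∃ k : ℕ, ∃ path : ℕ → (Fin d → ℤ),
          path 0 ∈ A ∧ path k ∈ B ∧ (∀ j ≤ k, path j ∈ boxK d n \ H) ∧
          ∀ j < k, latAdj d (path j) (path (j + 1)) := by
  obtain ⟨d, rfl⟩ : ∃ e, d = e + 1 := ⟨d - 1, by omega⟩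
  refine ⟨1 - (2 : ℝ) ^ (-((d + 1 : ℕ) : ℝ)⁻¹), sub_pos.2 ?_, ?_⟩
  · exact Real.rpow_lt_one_of_one_lt_of_neg (by norm_num) (by simp; positivity)
  intro n _ m hm A B H hA hB hH _ _ hmA hmB hdisj hlt
  rw [Set.disjoint_union_right] at hdisj
  by_contra hno
  have hexp : (((d + 1 : ℕ) : ℝ) - 1) / ((d + 1 : ℕ) : ℝ) = (d : ℝ) / (d + 1 : ℕ) := by
    push_cast
    ring
  rw [hexp] at hlt
  set U := reachableIn (d + 1) (boxK (d + 1) n \ H) A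
  have hUK : U ⊆ boxK (d + 1) n := (reachableIn_subset _ _ _).trans Set.sdiff_subset
  have hAU : A ⊆ U := subset_reachableIn fun x hx => ⟨hA hx, hdisj.1.notMem_of_mem_right hx⟩
  have hBU : B ⊆ boxK (d + 1) n \ U := by
    intro x hx
    refine ⟨hB hx, ?_⟩
    rintro ⟨k, path, h0, rfl, h⟩
    exact hno ⟨k, path, h0, hx, h⟩
  have hfin := boxK_finite (d + 1) n
  refine hlt.not_ge (separator_ncard_ge hm hUK hH (hmA.trans ?_) (hmB.trans ?_)
    fun a _ b hb hab ha => mem_reachableIn_of_latAdj ha hb hab)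
  · exact_mod_cast Set.ncard_le_ncard hAU (hfin.subset hUK)
  · exact_mod_cast Set.ncard_le_ncard hBU (hfin.subset Set.sdiff_subset)
end

section
/- Let K ≥ 1 and let x, z ∈ ℝ^d and R > 0 satisfy: a := ⟨x, e₁⟩ > 0, H := ⟨z, e₁⟩ ≥ a, ‖x‖ ≤ K·a, R ≤ a/2, and the closed segment {t·z : t ∈ [0,1]} contains a point at Euclidean distance at most R from x. Then ‖z − (H/a)·x‖ ≤ 2(1+K)·R·H/a. -/
/-- Let `K ≥ 1`, and let `x, z ∈ ℝ^d` and `R > 0` satisfy `a := ⟨x, e₁⟩ > 0`,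
`H := ⟨z, e₁⟩ ≥ a`, `‖x‖ ≤ K a`, `R ≤ a/2`, and suppose the segment `{t z : t ∈ [0,1]}` contains
a point at distance at most `R` from `x`.  Then `‖z − (H/a) x‖ ≤ 2(1+K) R H/a`. -/
theorem stmt_14 (d : ℕ) (hd : 3 ≤ d) (K : ℝ) (hK : 1 ≤ K)
    (x z : EuclideanSpace ℝ (Fin d)) (R : ℝ) (hR : 0 < R)
    (ha : 0 < x ⟨0, by omega⟩)
    (hH : x ⟨0, by omega⟩ ≤ z ⟨0, by omega⟩)
    (hxK : ‖x‖ ≤ K * x ⟨0, by omega⟩)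
    (hRa : R ≤ x ⟨0, by omega⟩ / 2)
    (hseg : ∃ t ∈ Set.Icc (0 : ℝ) 1, dist (t • z) x ≤ R) :
    ‖z - (z ⟨0, by omega⟩ / x ⟨0, by omega⟩) • x‖ ≤
      2 * (1 + K) * R * (z ⟨0, by omega⟩ / x ⟨0, by omega⟩) := by
  obtain ⟨t, ⟨ht, -⟩, hdist⟩ := hseg
  set i : Fin d := ⟨0, by omega⟩
  rw [dist_eq_norm] at hdist
  have hw : |t * z i - x i| ≤ R := by
    simpa using (PiLp.norm_apply_le (t • z - x) i).trans hdist
  have hdecomp : t • (z - (z i / x i) • x) = (t • z - x) - ((t * z i - x i) / x i) • x := by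
    match_scalars <;> field_simp
    ring
  have hscaled : t * ‖z - (z i / x i) • x‖ ≤ (1 + K) * R := by
    calc t * ‖z - (z i / x i) • x‖
        = ‖(t • z - x) - ((t * z i - x i) / x i) • x‖ := by
          rw [← hdecomp, norm_smul, Real.norm_of_nonneg ht]
      _ ≤ ‖t • z - x‖ + |t * z i - x i| / x i * ‖x‖ := by
          refine (norm_sub_le _ _).trans_eq ?_
          rw [norm_smul, Real.norm_eq_abs, abs_div, abs_of_pos ha]
      _ ≤ R + R / x i * (K * x i) := by gcongr
      _ = (1 + K) * R := by field_simp
  have hheight : x i ≤ 2 * (t * z i) := by linarith [(abs_le.mp hw).1]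
  rw [← mul_div_assoc, le_div_iff₀ ha]
  calc ‖z - (z i / x i) • x‖ * x i
      ≤ ‖z - (z i / x i) • x‖ * (2 * (t * z i)) := by gcongr
    _ = 2 * (t * ‖z - (z i / x i) • x‖) * z i := by ring
    _ ≤ 2 * ((1 + K) * R) * z i := by
        have hz : 0 ≤ z i := ha.le.trans hH
        gcongr
    _ = 2 * (1 + K) * R * z i := by ring
end
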